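/- arXiv:1804.06980 — 6 statements merged into one kernel-verified Lean document; each statement's English description precedes it below -/
import Mathlib

section
/- For every weight triple (p₁,p₂,p₃) of integers pᵢ ≥ 2, every element x of the group 𝕃(p₁,p₂,p₃) can be written uniquely in normal form x = l₁x⃗₁ + l₂x⃗₂ + l₃x⃗₃ + l·c⃗ with integers l₁, l₂, l₃, l satisfying 0 ≤ lᵢ ≤ pᵢ − 1 for i = 1,2,3 and l ∈ ℤ. -/
/-- The subgroup of relations defining the group `𝕃(p₁,p₂,p₃)`: `ℤ³` modulo the
subgroup generated by `p₁e₁ − p₂e₂` and `p₂e₂ − p₃e₃`. -/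
def wplRel (p : Fin 3 → ℕ) : AddSubgroup (Fin 3 → ℤ) :=
  AddSubgroup.closure
    { (p 0 : ℤ) • Pi.single (0 : Fin 3) (1 : ℤ) - (p 1 : ℤ) • Pi.single (1 : Fin 3) (1 : ℤ),
      (p 1 : ℤ) • Pi.single (1 : Fin 3) (1 : ℤ) - (p 2 : ℤ) • Pi.single (2 : Fin 3) (1 : ℤ) }

/-- The rank-one abelian group `𝕃(p₁,p₂,p₃)` with generators `x⃗₁, x⃗₂, x⃗₃` and relations
`p₁x⃗₁ = p₂x⃗₂ = p₃x⃗₃`. -/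
abbrev WPLGroup (p : Fin 3 → ℕ) : Type := (Fin 3 → ℤ) ⧸ wplRel p

/-- The generator `x⃗ᵢ` of `𝕃(p₁,p₂,p₃)` (class of the standard basis vector `eᵢ`). -/
def wplX (p : Fin 3 → ℕ) (i : Fin 3) : WPLGroup p :=
  QuotientAddGroup.mk (Pi.single i 1)

/-- The canonical element `c⃗ = p₁x⃗₁` of `𝕃(p₁,p₂,p₃)`. -/
def wplC (p : Fin 3 → ℕ) : WPLGroup p := (p 0 : ℤ) • wplX p 0

/-- The dualizing element `ω⃗ = c⃗ − x⃗₁ − x⃗₂ − x⃗₃` of `𝕃(p₁,p₂,p₃)`. -/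
def wplOmega (p : Fin 3 → ℕ) : WPLGroup p :=
  wplC p - wplX p 0 - wplX p 1 - wplX p 2

/-- The positive cone `𝕃₊`: the submonoid of `𝕃(p₁,p₂,p₃)` generated by `x⃗₁, x⃗₂, x⃗₃`. -/
def wplPos (p : Fin 3 → ℕ) : AddSubmonoid (WPLGroup p) :=
  AddSubmonoid.closure {wplX p 0, wplX p 1, wplX p 2}

theorem wpl_key (p : Fin 3 → ℕ) (v : Fin 3 → ℤ) (a b c l : ℤ) :
    ((QuotientAddGroup.mk v : WPLGroup p) =
      a • wplX p 0 + b • wplX p 1 + c • wplX p 2 + l • wplC p) ↔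
    ∃ m n : ℤ, a + l * p 0 - v 0 = m * p 0 ∧ b - v 1 = (n - m) * p 1 ∧ c - v 2 = - n * p 2 := by
  have h : (a • wplX p 0 + b • wplX p 1 + c • wplX p 2 + l • wplC p) =
      (QuotientAddGroup.mk (a • Pi.single (0 : Fin 3) (1 : ℤ) + b • Pi.single (1 : Fin 3) (1 : ℤ)
        + c • Pi.single (2 : Fin 3) (1 : ℤ)
        + l • ((p 0 : ℤ) • Pi.single (0 : Fin 3) (1 : ℤ))) : WPLGroup p) := rfl
  rw [h, QuotientAddGroup.eq, wplRel, AddSubgroup.mem_closure_pair]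
  refine exists_congr fun m => exists_congr fun n => ?_
  rw [funext_iff, Fin.forall_fin_succ, Fin.forall_fin_succ, Fin.forall_fin_succ]
  simp [Pi.single_apply]
  constructor
  · rintro ⟨h0, h1, h2⟩
    refine ⟨?_, ?_, ?_⟩ <;> linarith
  · rintro ⟨h0, h1, h2⟩
    refine ⟨?_, ?_, ?_⟩ <;> linarith

theorem wpl_divmod {P a v k : ℤ} (h0 : 0 ≤ a) (h1 : a ≤ P - 1) (h : a - v = k * P) :
    a = v % P ∧ k = - (v / P) := by
  have hP : 0 < P := by linarith
  have := (Int.ediv_emod_unique (a := v) (r := a) (q := -k) hP).2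
    ⟨by linarith, h0, by linarith⟩
  exact ⟨this.2.symm, by linarith [this.1]⟩

/-- For every weight triple `(p₁,p₂,p₃)` of integers `pᵢ ≥ 2`, every element
`x` of `𝕃(p₁,p₂,p₃)` can be written uniquely in normal form
`x = l₁x⃗₁ + l₂x⃗₂ + l₃x⃗₃ + l·c⃗` with `0 ≤ lᵢ ≤ pᵢ − 1` and `l ∈ ℤ`. -/
theorem normal_form_exists_unique (p : Fin 3 → ℕ) (hp : ∀ i, 2 ≤ p i) (x : WPLGroup p) :
    ∃! q : ℤ × ℤ × ℤ × ℤ,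
      (0 ≤ q.1 ∧ q.1 ≤ (p 0 : ℤ) - 1) ∧
      (0 ≤ q.2.1 ∧ q.2.1 ≤ (p 1 : ℤ) - 1) ∧
      (0 ≤ q.2.2.1 ∧ q.2.2.1 ≤ (p 2 : ℤ) - 1) ∧
      x = q.1 • wplX p 0 + q.2.1 • wplX p 1 + q.2.2.1 • wplX p 2 + q.2.2.2 • wplC p := by
  obtain ⟨v, rfl⟩ := QuotientAddGroup.mk_surjective x
  have hpos : ∀ i, (0 : ℤ) < p i := fun i => by have := hp i; omega
  have hb : ∀ i, 0 ≤ v i % p i ∧ v i % p i ≤ (p i : ℤ) - 1 := fun i =>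
    ⟨Int.emod_nonneg _ (hpos i).ne', by have := Int.emod_lt_of_pos (v i) (hpos i); omega⟩
  refine ⟨(v 0 % p 0, v 1 % p 1, v 2 % p 2, v 0 / p 0 + v 1 / p 1 + v 2 / p 2),
    ⟨hb 0, hb 1, hb 2, ?_⟩, ?_⟩
  · refine (wpl_key _ _ _ _ _ _).2 ⟨v 1 / p 1 + v 2 / p 2, v 2 / p 2, ?_, ?_, ?_⟩
    · linarith [Int.emod_add_mul_ediv (v 0) (p 0)]
    · linarith [Int.emod_add_mul_ediv (v 1) (p 1)]
    · linarith [Int.emod_add_mul_ediv (v 2) (p 2)]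
  · rintro ⟨a, b, c, l⟩ ⟨⟨ha, ha'⟩, ⟨hb, hb'⟩, ⟨hc, hc'⟩, h⟩
    obtain ⟨m, n, h0, h1, h2⟩ := (wpl_key _ _ _ _ _ _).1 h
    dsimp only at *
    obtain ⟨e0, f0⟩ := wpl_divmod (v := v 0) (k := m - l) ha ha' (by linarith)
    obtain ⟨e1, f1⟩ := wpl_divmod hb hb' h1
    obtain ⟨e2, f2⟩ := wpl_divmod hc hc' h2
    have : l = v 0 / p 0 + v 1 / p 1 + v 2 / p 2 := by linarith
    rw [e0, e1, e2, this]
end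

section
/- For every weight triple (p₁,p₂,p₃), an element x ∈ 𝕃(p₁,p₂,p₃) lies in the positive cone 𝕃₊ if and only if the coefficient l in its normal form x = l₁x⃗₁ + l₂x⃗₂ + l₃x⃗₃ + l·c⃗ (with 0 ≤ lᵢ ≤ pᵢ − 1) satisfies l ≥ 0. Consequently 𝕃₊ ∩ (−𝕃₊) = {0}, so the relation x ≤ y iff y − x ∈ 𝕃₊ is a partial order on 𝕃. -/
theorem wpl_rel_form (p : Fin 3 → ℕ) (v : Fin 3 → ℤ) (hv : v ∈ wplRel p) :
    ∃ s t u : ℤ, s + t + u = 0 ∧ v 0 = p 0 * s ∧ v 1 = p 1 * t ∧ v 2 = p 2 * u := by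
  unfold wplRel at hv
  induction hv using AddSubgroup.closure_induction with
  | mem x hx =>
    rcases hx with rfl | hx
    · exact ⟨1, -1, 0, by simp, by simp, by simp, by simp⟩
    · rw [Set.mem_singleton_iff] at hx
      subst hx
      exact ⟨0, 1, -1, by simp, by simp, by simp, by simp⟩
  | zero => exact ⟨0, 0, 0, by simp⟩
  | add x y _ _ hx hy =>
    obtain ⟨s, t, u, h, h0, h1, h2⟩ := hx
    obtain ⟨s', t', u', h', h0', h1', h2'⟩ := hy
    refine ⟨s + s', t + t', u + u', by linarith, ?_, ?_, ?_⟩ <;>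
      simp only [Pi.add_apply, *] <;> ring
  | neg x _ hx =>
    obtain ⟨s, t, u, h, h0, h1, h2⟩ := hx
    refine ⟨-s, -t, -u, by linarith, ?_, ?_, ?_⟩ <;>
      simp only [Pi.neg_apply, *] <;> ring

theorem wpl_mk (p : Fin 3 → ℕ) (a b c : ℤ) :
    a • wplX p 0 + b • wplX p 1 + c • wplX p 2 = QuotientAddGroup.mk ![a, b, c] := by
  have h : (![a, b, c] : Fin 3 → ℤ) =
      a • Pi.single 0 1 + b • Pi.single 1 1 + c • Pi.single 2 1 := by
    ext i
    fin_cases i <;> simp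
  rw [h]
  rfl

theorem wpl_zero_form (p : Fin 3 → ℕ) (a b c : ℤ)
    (h : a • wplX p 0 + b • wplX p 1 + c • wplX p 2 = 0) :
    ∃ s t u : ℤ, s + t + u = 0 ∧ a = p 0 * s ∧ b = p 1 * t ∧ c = p 2 * u := by
  rw [wpl_mk, QuotientAddGroup.eq_zero_iff] at h
  simpa using wpl_rel_form p _ h

theorem wpl_pos_form (p : Fin 3 → ℕ) (x : WPLGroup p) (hx : x ∈ wplPos p) :
    ∃ a b c : ℤ, 0 ≤ a ∧ 0 ≤ b ∧ 0 ≤ c ∧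
      x = a • wplX p 0 + b • wplX p 1 + c • wplX p 2 := by
  unfold wplPos at hx
  induction hx using AddSubmonoid.closure_induction with
  | mem x hx =>
    rcases hx with rfl | rfl | hx
    · exact ⟨1, 0, 0, by simp⟩
    · exact ⟨0, 1, 0, by simp⟩
    · rw [Set.mem_singleton_iff] at hx
      subst hx
      exact ⟨0, 0, 1, by simp⟩
  | zero => exact ⟨0, 0, 0, by simp⟩
  | add x y _ _ hx hy =>
    obtain ⟨a, b, c, ha, hb, hc, rfl⟩ := hx
    obtain ⟨a', b', c', ha', hb', hc', rfl⟩ := hy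
    exact ⟨a + a', b + b', c + c', by omega, by omega, by omega, by module⟩

theorem wpl_smul_mem (p : Fin 3 → ℕ) (x : WPLGroup p) (hx : x ∈ wplPos p) (a : ℤ)
    (ha : 0 ≤ a) : a • x ∈ wplPos p := by
  lift a to ℕ using ha
  rw [natCast_zsmul]
  exact AddSubmonoid.nsmul_mem _ hx a

/-- An element `x ∈ 𝕃(p₁,p₂,p₃)` lies in the positive cone `𝕃₊` iff the
coefficient `l` in its normal form `x = l₁x⃗₁ + l₂x⃗₂ + l₃x⃗₃ + l·c⃗` (with `0 ≤ lᵢ ≤ pᵢ − 1`)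
satisfies `l ≥ 0`. Consequently `𝕃₊ ∩ (−𝕃₊) = {0}`, so `x ≤ y ↔ y − x ∈ 𝕃₊` is a partial
order on `𝕃`. -/
theorem mem_pos_iff_normal_form_nonneg (p : Fin 3 → ℕ) (hp : ∀ i, 2 ≤ p i) :
    (∀ (x : WPLGroup p) (l₁ l₂ l₃ l : ℤ),
      0 ≤ l₁ → l₁ ≤ (p 0 : ℤ) - 1 →
      0 ≤ l₂ → l₂ ≤ (p 1 : ℤ) - 1 →
      0 ≤ l₃ → l₃ ≤ (p 2 : ℤ) - 1 →
      x = l₁ • wplX p 0 + l₂ • wplX p 1 + l₃ • wplX p 2 + l • wplC p →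
      (x ∈ wplPos p ↔ 0 ≤ l)) ∧
    (∀ x : WPLGroup p, x ∈ wplPos p → -x ∈ wplPos p → x = 0) := by
  have hp0 : (0 : ℤ) < p 0 := by have := hp 0; omega
  have hp1 : (0 : ℤ) < p 1 := by have := hp 1; omega
  have hp2 : (0 : ℤ) < p 2 := by have := hp 2; omega
  have m0 : wplX p 0 ∈ wplPos p := AddSubmonoid.subset_closure (by simp)
  have m1 : wplX p 1 ∈ wplPos p := AddSubmonoid.subset_closure (by simp)
  have m2 : wplX p 2 ∈ wplPos p := AddSubmonoid.subset_closure (by simp)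
  constructor
  · intro x l₁ l₂ l₃ l h1 h1' h2 h2' h3 h3' hx
    constructor
    · intro hpos
      obtain ⟨a, b, c, ha, hb, hc, hx'⟩ := wpl_pos_form p x hpos
      obtain ⟨s, t, u, hs, e0, e1, e2⟩ := wpl_zero_form p
        (l₁ + p 0 * l - a) (l₂ - b) (l₃ - c) (by
          have h := sub_eq_zero.mpr (hx.symm.trans hx')
          rw [← h, wplC]
          module)
      have k0 : -1 < l - s := by
        by_contra hc
        nlinarith
      have k1 : -1 < -t := by
        by_contra hc
        nlinarith
      have k2 : -1 < -u := by
        by_contra hc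
        nlinarith
      omega
    · intro hl
      rw [hx]
      exact add_mem (add_mem (add_mem (wpl_smul_mem p _ m0 _ h1) (wpl_smul_mem p _ m1 _ h2))
        (wpl_smul_mem p _ m2 _ h3))
        (wpl_smul_mem p _ (wpl_smul_mem p _ m0 _ hp0.le) _ hl)
  · intro x hx hnx
    obtain ⟨a, b, c, ha, hb, hc, e⟩ := wpl_pos_form p x hx
    obtain ⟨a', b', c', ha', hb', hc', e'⟩ := wpl_pos_form p _ hnx
    obtain ⟨s, t, u, hs, e0, e1, e2⟩ := wpl_zero_form p (a + a') (b + b') (c + c') (by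
      have h : x + -x = 0 := add_neg_cancel x
      rw [e', e] at h
      rw [← h]
      module)
    have k0 : 0 ≤ s := nonneg_of_mul_nonneg_right (by omega) hp0
    have k1 : 0 ≤ t := nonneg_of_mul_nonneg_right (by omega) hp1
    have k2 : 0 ≤ u := nonneg_of_mul_nonneg_right (by omega) hp2
    obtain rfl : s = 0 := by omega
    obtain rfl : t = 0 := by omega
    obtain rfl : u = 0 := by omega
    obtain rfl : a = 0 := by rw [mul_zero] at e0; omega
    obtain rfl : b = 0 := by rw [mul_zero] at e1; omega
    obtain rfl : c = 0 := by rw [mul_zero] at e2; omega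
    simpa using e
end

section
/- For every weight triple (p₁,p₂,p₃), the interval {x ∈ 𝕃 : 0 ≤ x ≤ c⃗} in 𝕃(p₁,p₂,p₃) equals {0, c⃗} ∪ {l·x⃗ᵢ : i ∈ {1,2,3}, 1 ≤ l ≤ pᵢ − 1}; in particular this interval has exactly (p₁ − 1) + (p₂ − 1) + (p₃ − 1) + 2 elements. -/
theorem wpl_mem_rel (p : Fin 3 → ℕ) (v : Fin 3 → ℤ) (h : v ∈ wplRel p) :
    ∃ k : Fin 3 → ℤ, k 0 + k 1 + k 2 = 0 ∧ ∀ i, v i = k i * p i := by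
  unfold wplRel at h
  induction h using AddSubgroup.closure_induction with
  | mem x hx =>
    rcases hx with rfl | rfl
    · refine ⟨![1, -1, 0], by simp, ?_⟩
      intro i; fin_cases i <;> simp
    · refine ⟨![0, 1, -1], by simp, ?_⟩
      intro i; fin_cases i <;> simp
  | zero => exact ⟨0, by simp, by simp⟩
  | add x y _ _ hx hy =>
    obtain ⟨k, hk, hk'⟩ := hx
    obtain ⟨m, hm, hm'⟩ := hy
    refine ⟨k + m, by simp only [Pi.add_apply]; linarith, fun i => ?_⟩
    simp only [Pi.add_apply, hk', hm']; ring
  | neg x _ hx =>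
    obtain ⟨k, hk, hk'⟩ := hx
    refine ⟨-k, by simp only [Pi.neg_apply]; linarith, fun i => ?_⟩
    simp only [Pi.neg_apply, hk']; ring

theorem wpl_mk_eq (p : Fin 3 → ℕ) (u v : Fin 3 → ℤ)
    (h : (QuotientAddGroup.mk u : WPLGroup p) = QuotientAddGroup.mk v) :
    ∃ k : Fin 3 → ℤ, k 0 + k 1 + k 2 = 0 ∧ ∀ i, v i - u i = k i * p i := by
  obtain ⟨k, hk, hk'⟩ := wpl_mem_rel p _ (QuotientAddGroup.eq.1 h)
  refine ⟨k, hk, fun i => ?_⟩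
  rw [← hk' i]; simp only [Pi.add_apply, Pi.neg_apply]; ring

theorem wpl_smulX (p : Fin 3 → ℕ) (l : ℤ) (i : Fin 3) :
    l • wplX p i = QuotientAddGroup.mk (Pi.single i l) := by
  unfold wplX
  rw [← QuotientAddGroup.mk_zsmul]
  congr 1
  ext j
  by_cases h : j = i
  · subst h; simp
  · simp [h]

theorem wpl_C (p : Fin 3 → ℕ) (i : Fin 3) : wplC p = (p i : ℤ) • wplX p i := by
  have h1 : (p 0 : ℤ) • wplX p 0 = (p 1 : ℤ) • wplX p 1 := by
    unfold wplX
    rw [← QuotientAddGroup.mk_zsmul, ← QuotientAddGroup.mk_zsmul, eq_comm,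
      QuotientAddGroup.eq, neg_add_eq_sub]
    exact AddSubgroup.subset_closure (by simp)
  have h2 : (p 1 : ℤ) • wplX p 1 = (p 2 : ℤ) • wplX p 2 := by
    unfold wplX
    rw [← QuotientAddGroup.mk_zsmul, ← QuotientAddGroup.mk_zsmul, eq_comm,
      QuotientAddGroup.eq, neg_add_eq_sub]
    exact AddSubgroup.subset_closure (by simp)
  unfold wplC
  fin_cases i
  · rfl
  · exact h1
  · exact h1.trans h2

theorem wpl_pos (p : Fin 3 → ℕ) (x : WPLGroup p) (h : x ∈ wplPos p) :
    ∃ a : Fin 3 → ℤ, (∀ i, 0 ≤ a i) ∧ x = QuotientAddGroup.mk a := by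
  unfold wplPos at h
  induction h using AddSubmonoid.closure_induction with
  | mem x hx =>
    have : ∃ i, x = wplX p i := by
      rcases hx with rfl | rfl | rfl <;> exact ⟨_, rfl⟩
    obtain ⟨i, rfl⟩ := this
    refine ⟨Pi.single i 1, fun j => ?_, rfl⟩
    by_cases h : j = i
    · subst h; simp
    · simp [h]
  | zero => exact ⟨0, by simp, rfl⟩
  | add x y _ _ hx hy =>
    obtain ⟨a, ha, rfl⟩ := hx
    obtain ⟨b, hb, rfl⟩ := hy
    exact ⟨a + b, fun i => add_nonneg (ha i) (hb i), rfl⟩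

theorem wpl_X_pos (p : Fin 3 → ℕ) (i : Fin 3) (l : ℤ) (hl : 0 ≤ l) :
    l • wplX p i ∈ wplPos p := by
  lift l to ℕ using hl
  rw [natCast_zsmul]
  apply AddSubmonoid.nsmul_mem
  apply AddSubmonoid.subset_closure
  fin_cases i <;> simp

theorem wpl_interval (p : Fin 3 → ℕ) (hp : ∀ i, 2 ≤ p i) (x : WPLGroup p) :
    (x ∈ wplPos p ∧ wplC p - x ∈ wplPos p) ↔
      ∃ (i : Fin 3) (l : ℤ), 0 ≤ l ∧ l ≤ p i ∧ x = l • wplX p i := by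
  constructor
  · rintro ⟨h1, h2⟩
    obtain ⟨a, ha, rfl⟩ := wpl_pos p x h1
    obtain ⟨b, hb, hab⟩ := wpl_pos p _ h2
    have h3 : (QuotientAddGroup.mk (Pi.single 0 (p 0 : ℤ)) : WPLGroup p)
        = QuotientAddGroup.mk (b + a) := by
      rw [QuotientAddGroup.mk_add, ← hab, ← wpl_smulX, ← wpl_C p 0]; abel
    obtain ⟨k, hk, hk'⟩ := wpl_mk_eq p _ _ h3
    have e0 := hk' 0
    have e1 := hk' 1
    have e2 := hk' 2
    simp at e0 e1 e2
    have q0 : (2:ℤ) ≤ p 0 := by exact_mod_cast hp 0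
    have q1 : (2:ℤ) ≤ p 1 := by exact_mod_cast hp 1
    have q2 : (2:ℤ) ≤ p 2 := by exact_mod_cast hp 2
    have a0 := ha 0
    have a1 := ha 1
    have a2 := ha 2
    have b0 := hb 0
    have b1 := hb 1
    have b2 := hb 2
    have k0 : -1 ≤ k 0 := by
      by_contra h; push Not at h; nlinarith
    have k1 : 0 ≤ k 1 := by
      by_contra h; push Not at h; nlinarith
    have k2 : 0 ≤ k 2 := by
      by_contra h; push Not at h; nlinarith
    have cases : (k 0 = 0 ∧ k 1 = 0 ∧ k 2 = 0) ∨ (k 0 = -1 ∧ k 1 = 1 ∧ k 2 = 0) ∨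
      (k 0 = -1 ∧ k 1 = 0 ∧ k 2 = 1) := by omega
    rcases cases with ⟨h0, h1, h2⟩ | ⟨h0, h1, h2⟩ | ⟨h0, h1, h2⟩ <;>
      rw [h0] at e0 <;> rw [h1] at e1 <;> rw [h2] at e2
    · refine ⟨0, a 0, a0, by linarith, ?_⟩
      rw [wpl_smulX]; congr 1; ext j; fin_cases j <;> simp <;> linarith
    · refine ⟨1, a 1, a1, by linarith, ?_⟩
      rw [wpl_smulX]; congr 1; ext j; fin_cases j <;> simp <;> linarith
    · refine ⟨2, a 2, a2, by linarith, ?_⟩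
      rw [wpl_smulX]; congr 1; ext j; fin_cases j <;> simp <;> linarith
  · rintro ⟨i, l, h0, h1, rfl⟩
    refine ⟨wpl_X_pos p i l h0, ?_⟩
    rw [wpl_C p i, ← sub_smul]
    exact wpl_X_pos p i _ (by linarith)

/-- Representatives of the interval elements. -/
def wplRep (p : Fin 3 → ℕ) : Bool ⊕ (Σ i : Fin 3, Fin (p i - 1)) → (Fin 3 → ℤ)
  | Sum.inl false => 0
  | Sum.inl true => Pi.single 0 (p 0 : ℤ)
  | Sum.inr ⟨i, l⟩ => Pi.single i ((l : ℕ) + 1 : ℤ)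

theorem wpl_small (m k P : ℤ) (h1 : -P < m) (h2 : m < P) (h : m = k * P) : m = 0 := by
  have : k = 0 := by
    have hP : 0 < P := by linarith
    have a : k < 1 := by by_contra hh; push Not at hh; nlinarith
    have b : -1 < k := by by_contra hh; push Not at hh; nlinarith
    omega
  simp [h, this]

theorem wpl_rep_inj (p : Fin 3 → ℕ) (hp : ∀ i, 2 ≤ p i) :
    Function.Injective (fun t => (QuotientAddGroup.mk (wplRep p t) : WPLGroup p)) := by
  have q : ∀ i, (2:ℤ) ≤ p i := fun i => by exact_mod_cast hp i
  -- zero or c against a middle element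
  have key0 : ∀ (i : Fin 3) (l : ℕ), l < p i - 1 →
      (0 : WPLGroup p) ≠ ((l : ℤ) + 1) • wplX p i := by
    intro i l hl h
    rw [wpl_smulX] at h
    obtain ⟨k, hk, hk'⟩ := wpl_mk_eq p 0 _ h
    have e := hk' i
    simp at e
    have := wpl_small _ _ _ (by have := q i; omega) (by omega) e
    omega
  have keyC : ∀ (i : Fin 3) (l : ℕ), l < p i - 1 →
      wplC p ≠ ((l : ℤ) + 1) • wplX p i := by
    intro i l hl h
    rw [wpl_C p i, ← sub_eq_zero, ← sub_smul] at h
    refine key0 i (p i - 2 - l) (by omega) ?_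
    rw [← h]; congr 1; have := hp i; omega
  have keyZ : (0 : WPLGroup p) ≠ wplC p := by
    intro h
    rw [wpl_C p 0, wpl_smulX] at h
    obtain ⟨k, hk, hk'⟩ := wpl_mk_eq p 0 _ h
    have e0 := hk' 0
    have e1 := hk' 1
    have e2 := hk' 2
    have := q 0
    have := q 1
    have := q 2
    simp at e0 e1 e2
    have := hp 0
    have := hp 1
    have := hp 2
    have k1 : k 1 = 0 := by omega
    have k2 : k 2 = 0 := by omega
    have k0 : k 0 = 0 := by omega
    rw [k0] at e0
    omega
  have keyM : ∀ (i j : Fin 3) (l m : ℕ), l < p i - 1 → m < p j - 1 →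
      ((l : ℤ) + 1) • wplX p i = ((m : ℤ) + 1) • wplX p j → i = j ∧ l = m := by
    intro i j l m hl hm h
    rw [wpl_smulX, wpl_smulX] at h
    obtain ⟨k, hk, hk'⟩ := wpl_mk_eq p _ _ h
    have e := hk' i
    by_cases hij : i = j
    · subst hij
      simp at e
      have := wpl_small _ _ _ (by omega) (by omega) e
      exact ⟨rfl, by omega⟩
    · simp [hij] at e
      have := wpl_small _ _ _ (by omega) (by omega) e
      omega
  have r0 : (QuotientAddGroup.mk (wplRep p (Sum.inl false)) : WPLGroup p) = 0 := rfl
  have rC : (QuotientAddGroup.mk (wplRep p (Sum.inl true)) : WPLGroup p) = wplC p := by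
    rw [wpl_C p 0, wpl_smulX]; rfl
  have rM : ∀ i l, (QuotientAddGroup.mk (wplRep p (Sum.inr ⟨i, l⟩)) : WPLGroup p) =
      (((l : ℕ) : ℤ) + 1) • wplX p i := by
    intro i l
    rw [wpl_smulX]; rfl
  rintro ((_ | _) | ⟨i, l⟩) ((_ | _) | ⟨j, m⟩) h <;> simp only [r0, rC, rM] at h
  · rfl
  · exact absurd h keyZ
  · exact absurd h (key0 _ _ m.2)
  · exact absurd h.symm keyZ
  · rfl
  · exact absurd h (keyC _ _ m.2)
  · exact absurd h.symm (key0 _ _ l.2)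
  · exact absurd h.symm (keyC _ _ l.2)
  · obtain ⟨rfl, h2⟩ := keyM _ _ _ _ l.2 m.2 h
    rw [Fin.ext h2]

/-- The interval `{x ∈ 𝕃 : 0 ≤ x ≤ c⃗}` in `𝕃(p₁,p₂,p₃)` (where `x ≤ y` iff
`y − x ∈ 𝕃₊`) equals `{0, c⃗} ∪ {l·x⃗ᵢ : i ∈ {1,2,3}, 1 ≤ l ≤ pᵢ − 1}`; in particular this
interval has exactly `(p₁ − 1) + (p₂ − 1) + (p₃ − 1) + 2` elements. -/
theorem interval_zero_c (p : Fin 3 → ℕ) (hp : ∀ i, 2 ≤ p i) :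
    {x : WPLGroup p | x ∈ wplPos p ∧ wplC p - x ∈ wplPos p} =
      ({0, wplC p} : Set (WPLGroup p)) ∪
        {x : WPLGroup p | ∃ (i : Fin 3) (l : ℤ), 1 ≤ l ∧ l ≤ (p i : ℤ) - 1 ∧ x = l • wplX p i} ∧
    {x : WPLGroup p | x ∈ wplPos p ∧ wplC p - x ∈ wplPos p}.ncard =
      (p 0 - 1) + (p 1 - 1) + (p 2 - 1) + 2 := by
  have first : {x : WPLGroup p | x ∈ wplPos p ∧ wplC p - x ∈ wplPos p} =
      ({0, wplC p} : Set (WPLGroup p)) ∪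
        {x : WPLGroup p | ∃ (i : Fin 3) (l : ℤ), 1 ≤ l ∧ l ≤ (p i : ℤ) - 1 ∧
          x = l • wplX p i} := by
    ext x
    rw [Set.mem_ofPred_eq, wpl_interval p hp]
    constructor
    · rintro ⟨i, l, h0, h1, rfl⟩
      rcases h0.eq_or_lt with rfl | h0
      · left; left; simp
      rcases h1.eq_or_lt with rfl | h1
      · left; right; exact (wpl_C p i).symm
      · right; exact ⟨i, l, by omega, by omega, rfl⟩
    · rintro ((rfl | rfl) | ⟨i, l, h0, h1, rfl⟩)
      · exact ⟨0, 0, le_rfl, by positivity, by simp⟩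
      · exact ⟨0, p 0, by positivity, le_rfl, rfl⟩
      · exact ⟨i, l, by omega, by omega, rfl⟩
  refine ⟨first, ?_⟩
  have hr : {x : WPLGroup p | x ∈ wplPos p ∧ wplC p - x ∈ wplPos p} =
      Set.range (fun t => (QuotientAddGroup.mk (wplRep p t) : WPLGroup p)) := by
    rw [first]
    ext x
    constructor
    · rintro ((rfl | rfl) | ⟨i, l, h0, h1, rfl⟩)
      · exact ⟨Sum.inl false, rfl⟩
      · refine ⟨Sum.inl true, ?_⟩
        rw [wpl_C p 0, wpl_smulX]; rfl
      · refine ⟨Sum.inr ⟨i, ⟨(l - 1).toNat, by omega⟩⟩, ?_⟩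
        rw [wpl_smulX]
        have : l = (((l - 1).toNat : ℕ) : ℤ) + 1 := by omega
        conv_rhs => rw [this]
        rfl
    · rintro ⟨(_ | _) | ⟨i, l⟩, rfl⟩
      · left; left; rfl
      · left; right
        rw [Set.mem_singleton_iff, wpl_C p 0, wpl_smulX]; rfl
      · right
        refine ⟨i, (l : ℕ) + 1, by omega, by omega, ?_⟩
        rw [wpl_smulX]; rfl
  rw [hr, ← Nat.card_coe_set_eq, Nat.card_range_of_injective (wpl_rep_inj p hp)]
  simp [Fin.sum_univ_three]
  omega
end

section
/- For every weight triple (p₁,p₂,p₃) and every i ∈ {1,2,3}, the element x⃗ᵢ + 2ω⃗ of 𝕃(p₁,p₂,p₃) does not lie in the positive cone 𝕃₊; equivalently, there is no y ∈ 𝕃 with 0 ≤ y ≤ x⃗ᵢ + 2ω⃗. -/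
theorem wplRel_form (p : Fin 3 → ℕ) (v : Fin 3 → ℤ) (hv : v ∈ wplRel p) :
    ∃ a b c : ℤ, v 0 = p 0 * a ∧ v 1 = p 1 * b ∧ v 2 = p 2 * c ∧ a + b + c = 0 := by
  unfold wplRel at hv
  induction hv using AddSubgroup.closure_induction with
  | mem x hx =>
    rcases hx with rfl | rfl
    · exact ⟨1, -1, 0, by simp, by simp, by simp, by simp⟩
    · exact ⟨0, 1, -1, by simp, by simp, by simp, by simp⟩
  | zero => exact ⟨0, 0, 0, by simp, by simp, by simp, by simp⟩
  | add x y _ _ hx hy =>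
    obtain ⟨a, b, c, h0, h1, h2, h3⟩ := hx
    obtain ⟨a', b', c', k0, k1, k2, k3⟩ := hy
    refine ⟨a + a', b + b', c + c', ?_, ?_, ?_, by linarith⟩
    · rw [Pi.add_apply, h0, k0]; ring
    · rw [Pi.add_apply, h1, k1]; ring
    · rw [Pi.add_apply, h2, k2]; ring
  | neg x _ hx =>
    obtain ⟨a, b, c, h0, h1, h2, h3⟩ := hx
    refine ⟨-a, -b, -c, ?_, ?_, ?_, by linarith⟩
    · rw [Pi.neg_apply, h0]; ring
    · rw [Pi.neg_apply, h1]; ring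
    · rw [Pi.neg_apply, h2]; ring

theorem wplPos_rep (p : Fin 3 → ℕ) (x : WPLGroup p) (hx : x ∈ wplPos p) :
    ∃ w : Fin 3 → ℤ, (∀ k, 0 ≤ w k) ∧ (QuotientAddGroup.mk w : WPLGroup p) = x := by
  have key : ∀ i k : Fin 3, 0 ≤ (Pi.single i 1 : Fin 3 → ℤ) k := by decide
  unfold wplPos at hx
  induction hx using AddSubmonoid.closure_induction with
  | mem x hx =>
    rcases hx with rfl | rfl | rfl
    · exact ⟨_, key 0, rfl⟩
    · exact ⟨_, key 1, rfl⟩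
    · exact ⟨_, key 2, rfl⟩
  | zero => exact ⟨0, fun _ => le_rfl, rfl⟩
  | add x y _ _ hx hy =>
    obtain ⟨v, hv, rfl⟩ := hx
    obtain ⟨w, hw, rfl⟩ := hy
    exact ⟨v + w, fun k => add_nonneg (hv k) (hw k), rfl⟩

theorem wpl_not_pos (p : Fin 3 → ℕ) (hp : ∀ i, 2 ≤ p i) (i : Fin 3) :
    wplX p i + 2 • wplOmega p ∉ wplPos p := by
  intro h
  obtain ⟨w, hw, he⟩ := wplPos_rep p _ h
  have e : wplX p i + 2 • wplOmega p = (QuotientAddGroup.mk (Pi.single i 1 + 2 •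
      ((p 0 : ℤ) • Pi.single (0 : Fin 3) (1 : ℤ) - Pi.single 0 1 - Pi.single 1 1
        - Pi.single 2 1)) : WPLGroup p) := rfl
  rw [e, QuotientAddGroup.eq] at he
  obtain ⟨a, b, c, h0, h1, h2, h3⟩ := wplRel_form p _ he
  have key : ∀ i k : Fin 3, (Pi.single i 1 : Fin 3 → ℤ) k ≤ 1 := by decide
  have s0 := key i 0
  have s1 := key i 1
  have s2 := key i 2
  have w0 := hw 0
  have w1 := hw 1
  have w2 := hw 2
  have p0 : (2 : ℤ) ≤ p 0 := by exact_mod_cast hp 0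
  have p1 : (2 : ℤ) ≤ p 1 := by exact_mod_cast hp 1
  have p2 : (2 : ℤ) ≤ p 2 := by exact_mod_cast hp 2
  simp only [Pi.add_apply, Pi.neg_apply, Pi.sub_apply, Pi.smul_apply] at h0 h1 h2
  simp [-Pi.single_apply] at h0 h1 h2
  have ha : a < 2 := by
    by_contra hc
    nlinarith
  have hb : b < 0 := by
    by_contra hc
    nlinarith
  have hc : c < 0 := by
    by_contra hc
    nlinarith
  omega

/-- For every weight triple `(p₁,p₂,p₃)` and every `i`, the element
`x⃗ᵢ + 2ω⃗` of `𝕃(p₁,p₂,p₃)` does not lie in the positive cone `𝕃₊`; equivalently, there is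
no `y ∈ 𝕃` with `0 ≤ y ≤ x⃗ᵢ + 2ω⃗` (where `x ≤ y` iff `y − x ∈ 𝕃₊`). -/
theorem x_add_two_omega_not_pos (p : Fin 3 → ℕ) (hp : ∀ i, 2 ≤ p i) (i : Fin 3) :
    wplX p i + 2 • wplOmega p ∉ wplPos p ∧
    ¬ ∃ y : WPLGroup p, y ∈ wplPos p ∧ (wplX p i + 2 • wplOmega p) - y ∈ wplPos p := by
  refine ⟨wpl_not_pos p hp i, ?_⟩
  rintro ⟨y, hy, hz⟩
  apply wpl_not_pos p hp i
  have := add_mem hz hy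
  rwa [sub_add_cancel] at this
end

section
/- For every weight triple (p₁,p₂,p₃), all distinct indices i, j, k with {i,j,k} = {1,2,3}, and all integers 0 ≤ l_j ≤ p_j − 1 and 0 ≤ l_k ≤ p_k − 1, the element l_j·x⃗_j + l_k·x⃗_k − x⃗ᵢ of 𝕃(p₁,p₂,p₃) does not lie in the positive cone 𝕃₊; equivalently, x⃗ᵢ ≰ l_j·x⃗_j + l_k·x⃗_k. -/
theorem wplRel_aux (p : Fin 3 → ℕ) (v : Fin 3 → ℤ) (hv : v ∈ wplRel p) :
    ∃ a : Fin 3 → ℤ, a 0 + a 1 + a 2 = 0 ∧ ∀ i, v i = a i * p i := by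
  unfold wplRel at hv
  induction hv using AddSubgroup.closure_induction with
  | mem x hx =>
    rcases hx with rfl | rfl
    · refine ⟨![1, -1, 0], by simp, fun i => ?_⟩
      fin_cases i <;> simp
    · refine ⟨![0, 1, -1], by simp, fun i => ?_⟩
      fin_cases i <;> simp
  | zero => exact ⟨0, by simp, by simp⟩
  | add x y _ _ hx hy =>
    obtain ⟨a, ha, hx⟩ := hx
    obtain ⟨b, hb, hy⟩ := hy
    refine ⟨a + b, by simp only [Pi.add_apply]; linarith, fun i => ?_⟩
    simp only [Pi.add_apply, hx, hy]; ring
  | neg x _ hx =>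
    obtain ⟨a, ha, hx⟩ := hx
    refine ⟨-a, by simp only [Pi.neg_apply]; linarith, fun i => ?_⟩
    simp only [Pi.neg_apply, hx]; ring

theorem wplPos_aux (p : Fin 3 → ℕ) (x : WPLGroup p) (hx : x ∈ wplPos p) :
    ∃ n : Fin 3 → ℤ, (∀ i, 0 ≤ n i) ∧ (QuotientAddGroup.mk n : WPLGroup p) = x := by
  have key : ∀ j : Fin 3, ∀ i, 0 ≤ (Pi.single j 1 : Fin 3 → ℤ) i := by decide
  unfold wplPos at hx
  induction hx using AddSubmonoid.closure_induction with
  | mem x hx =>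
    rcases hx with rfl | rfl | rfl
    · exact ⟨_, key 0, rfl⟩
    · exact ⟨_, key 1, rfl⟩
    · exact ⟨_, key 2, rfl⟩
  | zero => exact ⟨0, by simp, rfl⟩
  | add x y _ _ hx hy =>
    obtain ⟨a, ha, rfl⟩ := hx
    obtain ⟨b, hb, rfl⟩ := hy
    exact ⟨a + b, fun i => add_nonneg (ha i) (hb i), rfl⟩

/-- For all distinct indices `i, j, k` with `{i,j,k} = {1,2,3}` and integers
`0 ≤ l_j ≤ p_j − 1`, `0 ≤ l_k ≤ p_k − 1`, the element `l_j·x⃗_j + l_k·x⃗_k − x⃗ᵢ` of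
`𝕃(p₁,p₂,p₃)` does not lie in the positive cone `𝕃₊`; equivalently `x⃗ᵢ ≰ l_j·x⃗_j + l_k·x⃗_k`. -/
theorem combination_sub_x_not_pos (p : Fin 3 → ℕ) (hp : ∀ i, 2 ≤ p i) (i j k : Fin 3)
    (hij : i ≠ j) (hik : i ≠ k) (hjk : j ≠ k)
    (lj lk : ℤ) (hlj0 : 0 ≤ lj) (hlj1 : lj ≤ (p j : ℤ) - 1)
    (hlk0 : 0 ≤ lk) (hlk1 : lk ≤ (p k : ℤ) - 1) :
    lj • wplX p j + lk • wplX p k - wplX p i ∉ wplPos p := by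
  intro h
  obtain ⟨n, hn, he⟩ := wplPos_aux p _ h
  have he2 : (QuotientAddGroup.mk n : WPLGroup p) =
      QuotientAddGroup.mk (lj • Pi.single j 1 + lk • Pi.single k 1 - Pi.single i 1) := he
  rw [QuotientAddGroup.eq] at he2
  obtain ⟨a, ha, hv⟩ := wplRel_aux p _ he2
  have hi := hv i
  have hj := hv j
  have hk := hv k
  simp [hij, hik, hjk, hij.symm, hik.symm, hjk.symm] at hi hj hk
  have hs : a i + a j + a k = 0 := by
    clear hi hj hk hv he2 he h hlj1 hlk1
    fin_cases i <;> fin_cases j <;> fin_cases k <;> simp_all <;> linarith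
  have h1 : a i < 0 := by
    by_contra hc
    nlinarith [hn i, mul_nonneg (not_lt.mp hc) (Int.natCast_nonneg (p i))]
  have h2 : a j ≤ 0 := by
    by_contra hc
    nlinarith [hn j, mul_nonneg (show 0 ≤ a j - 1 by omega) (Int.natCast_nonneg (p j))]
  have h3 : a k ≤ 0 := by
    by_contra hc
    nlinarith [hn k, mul_nonneg (show 0 ≤ a k - 1 by omega) (Int.natCast_nonneg (p k))]
  omega
end

section
/- For every weight triple (p₁,p₂,p₃), every field k, and every λ ∈ k with λ ≠ 0, the 𝕃-graded algebra S = k[X₁,X₂,X₃]/(X₃^{p₃} − X₂^{p₂} + λX₁^{p₁}) satisfies: the homogeneous component S_z is nonzero if and only if z lies in the positive cone 𝕃₊ of 𝕃(p₁,p₂,p₃). -/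
/-- The ideal of `k[X₁,X₂,X₃]` generated by the canonical relation
`X₃^{p₃} − X₂^{p₂} + λX₁^{p₁}` (variables indexed by `Fin 3`, so `X 0 = X₁`, etc.). -/
noncomputable def wplIdeal (p : Fin 3 → ℕ) (k : Type*) [Field k] (lam : k) :
    Ideal (MvPolynomial (Fin 3) k) :=
  Ideal.span {MvPolynomial.X 2 ^ p 2 - MvPolynomial.X 1 ^ p 1 +
    MvPolynomial.C lam * MvPolynomial.X 0 ^ p 0}

/-- The homogeneous component `S_z` of the `𝕃`-graded algebra
`S = k[X₁,X₂,X₃]/(X₃^{p₃} − X₂^{p₂} + λX₁^{p₁})`, where `deg Xᵢ = x⃗ᵢ`: the image in `S`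
of the submodule of polynomials that are weighted-homogeneous of degree `z` for the weights
`w i = x⃗ᵢ`. -/
noncomputable def wplComponent (p : Fin 3 → ℕ) (k : Type*) [Field k] (lam : k)
    (z : WPLGroup p) : Submodule k (MvPolynomial (Fin 3) k ⧸ wplIdeal p k lam) :=
  Submodule.map (Ideal.Quotient.mkₐ k (wplIdeal p k lam)).toLinearMap
    (MvPolynomial.weightedHomogeneousSubmodule k (wplX p) z)

/-- For every weight triple `(p₁,p₂,p₃)`, every field `k` and every
`λ ≠ 0`, the homogeneous component `S_z` of
`S = k[X₁,X₂,X₃]/(X₃^{p₃} − X₂^{p₂} + λX₁^{p₁})` is nonzero iff `z` lies in the positive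
cone `𝕃₊` of `𝕃(p₁,p₂,p₃)`. -/
theorem component_ne_bot_iff_pos (p : Fin 3 → ℕ) (hp : ∀ i, 2 ≤ p i)
    (k : Type*) [Field k] (lam : k) (hlam : lam ≠ 0) (z : WPLGroup p) :
    wplComponent p k lam z ≠ ⊥ ↔ z ∈ wplPos p := by
  have hX : ∀ i, wplX p i ∈ wplPos p := by
    intro i
    apply AddSubmonoid.subset_closure
    fin_cases i <;> simp
  constructor
  · intro h
    by_contra hz
    apply h
    rw [wplComponent, eq_bot_iff, Submodule.map_le_iff_le_comap]
    intro f hf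
    have hf0 : f = 0 := by
      ext d
      by_contra hd
      rw [MvPolynomial.mem_weightedHomogeneousSubmodule] at hf
      have := hf hd
      apply hz
      rw [← this, Finsupp.weight_apply]
      exact AddSubmonoid.sum_mem _ fun i _ => AddSubmonoid.nsmul_mem _ (hX i) _
    simp [hf0]
  · intro hz
    have hd : ∃ d : Fin 3 →₀ ℕ, Finsupp.weight (wplX p) d = z := by
      have : wplPos p ≤ AddMonoidHom.mrange (Finsupp.weight (R := ℕ) (wplX p)) := by
        rw [wplPos, AddSubmonoid.closure_le]
        rintro x (rfl | rfl | rfl)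
        · exact ⟨Finsupp.single 0 1, by simp [Finsupp.weight_apply]⟩
        · exact ⟨Finsupp.single 1 1, by simp [Finsupp.weight_apply]⟩
        · exact ⟨Finsupp.single 2 1, by simp [Finsupp.weight_apply]⟩
      exact this hz
    obtain ⟨d, hd⟩ := hd
    intro hbot
    have hmem : MvPolynomial.monomial d (1 : k) ∈ wplIdeal p k lam := by
      have h1 : (Ideal.Quotient.mkₐ k (wplIdeal p k lam)).toLinearMap
          (MvPolynomial.monomial d (1 : k)) ∈ wplComponent p k lam z :=
        Submodule.mem_map_of_mem
          (MvPolynomial.isWeightedHomogeneous_monomial _ d (1 : k) hd)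
      rw [hbot, Submodule.mem_bot] at h1
      exact Ideal.Quotient.eq_zero_iff_mem.mp h1
    classical
    let K := AlgebraicClosure k
    obtain ⟨s, hs⟩ := Infinite.exists_notMem_finset ({0, algebraMap k K lam} : Finset K)
    simp only [Finset.mem_insert, Finset.mem_singleton, not_or] at hs
    have hp' : ∀ i, 0 < p i := fun i => by have := hp i; omega
    obtain ⟨t, ht⟩ := IsAlgClosed.exists_pow_nat_eq s (hp' 1)
    obtain ⟨u, hu⟩ := IsAlgClosed.exists_pow_nat_eq (s - algebraMap k K lam) (hp' 2)
    have ht0 : t ≠ 0 := by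
      rintro rfl
      rw [zero_pow (hp' 1).ne'] at ht
      exact hs.1 ht.symm
    have hu0 : u ≠ 0 := by
      rintro rfl
      rw [zero_pow (hp' 2).ne'] at hu
      exact hs.2 (sub_eq_zero.mp hu.symm)
    rw [wplIdeal, Ideal.mem_span_singleton] at hmem
    obtain ⟨g, hg⟩ := hmem
    have h2 := congrArg (MvPolynomial.aeval ![(1 : K), t, u]) hg
    rw [map_mul] at h2
    have h3 : MvPolynomial.aeval ![(1 : K), t, u] (MvPolynomial.X 2 ^ p 2 -
        MvPolynomial.X 1 ^ p 1 + MvPolynomial.C lam * MvPolynomial.X 0 ^ p 0) = 0 := by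
      simp [ht, hu]
    rw [h3, zero_mul, MvPolynomial.aeval_monomial, map_one, one_mul, Finsupp.prod,
      Finset.prod_eq_zero_iff] at h2
    obtain ⟨i, _, hi⟩ := h2
    have hi' := eq_zero_of_pow_eq_zero hi
    fin_cases i
    · simp at hi'
    · exact ht0 (by simpa using hi')
    · exact hu0 (by simpa using hi')
end
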